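/- Let U be a unital associative algebra over a field 𝔽 of characteristic 0 with center Z, and let A(z) ∈ Mat_{N×N}(U((z^{−1}))) be an operator of Yangian type. Let I ∈ Mat_{N×M}(Z) and J ∈ Mat_{M×N}(Z) with M ≤ N. If A(z) is invertible in Mat_{N×N}(U((z^{−1}))) and J·A(z)^{−1}·I is invertible in Mat_{M×M}(U((z^{−1}))), then the generalized quasideterminant |A(z)|_{IJ} := (J·A(z)^{−1}·I)^{−1} is an operator of Yangian type. -/

import Mathlib

/-- A matrix `A(z)` with entries in `U((z⁻¹))` (formal Laurent series in `z⁻¹`, realized as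
`LaurentSeries U = HahnSeries ℤ U` in the variable `t = z⁻¹`, so that `(A i j).coeff n` is the
coefficient of `z^{−n}` in `A_{ij}(z)`) is an *operator of Yangian type* for the associative
algebra `U` if `(z−w)[A_{ij}(z), A_{hk}(w)] = A_{hj}(w)A_{ik}(z) − A_{hj}(z)A_{ik}(w)` holds,
i.e. coefficient-wise: for all `m n : ℤ`,
`[a_{ij,m+1}, a_{hk,n}] − [a_{ij,m}, a_{hk,n+1}] = a_{hj,n} a_{ik,m} − a_{hj,m} a_{ik,n}`,
where `a_{ij,m} = (A i j).coeff m` and `[x,y] = xy − yx`. -/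
def IsYangianType {U : Type*} [Ring U] {M N : Type*}
    (A : Matrix M N (LaurentSeries U)) : Prop :=
  ∀ (i h : M) (j k : N) (m n : ℤ),
    ((A i j).coeff (m + 1) * (A h k).coeff n - (A h k).coeff n * (A i j).coeff (m + 1)) -
      ((A i j).coeff m * (A h k).coeff (n + 1) - (A h k).coeff (n + 1) * (A i j).coeff m) =
    (A h j).coeff n * (A i k).coeff m - (A h j).coeff m * (A i k).coeff n

section YangianHelpers

namespace YangianAux

variable {R : Type*} [Ring R]

/-- `P ⊗ 1`. -/
def T1 {n : Type*} [DecidableEq n] (P : Matrix n n R) : Matrix (n × n) (n × n) R :=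
  Matrix.of fun p q => if p.2 = q.2 then P p.1 q.1 else 0

/-- `1 ⊗ Q`. -/
def T2 {n : Type*} [DecidableEq n] (Q : Matrix n n R) : Matrix (n × n) (n × n) R :=
  Matrix.of fun p q => if p.1 = q.1 then Q p.2 q.2 else 0

/-- The permutation matrix. -/
def S (R : Type*) [Ring R] (n : Type*) [DecidableEq n] : Matrix (n × n) (n × n) R :=
  Matrix.of fun p q => if p = q.swap then 1 else 0

variable {n : Type*} [Fintype n] [DecidableEq n]

lemma T1_inv {P P' : Matrix n n R} (h : P * P' = 1) : T1 P * T1 P' = 1 := by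
  ext ⟨i, k⟩ ⟨j, l⟩
  have := congrFun (congrFun h i) j
  rw [Matrix.mul_apply] at this
  simp only [T1, Matrix.mul_apply, Matrix.of_apply, Fintype.sum_prod_type, ite_mul, mul_ite,
    zero_mul, mul_zero, Finset.sum_ite_eq, Finset.mem_univ, if_true, Matrix.one_apply,
    Prod.mk.injEq] at this ⊢
  by_cases hk : k = l
  · simp [hk, this]
  · simp [hk]

lemma T2_inv {P P' : Matrix n n R} (h : P * P' = 1) : T2 P * T2 P' = 1 := by
  ext ⟨k, i⟩ ⟨l, j⟩
  have := congrFun (congrFun h i) j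
  rw [Matrix.mul_apply] at this
  simp only [T2, Matrix.mul_apply, Matrix.of_apply, Fintype.sum_prod_type_right, ite_mul, mul_ite,
    zero_mul, mul_zero, Finset.sum_ite_eq, Finset.mem_univ, if_true, Matrix.one_apply,
    Prod.mk.injEq] at this ⊢
  by_cases hk : k = l
  · simp [hk, this]
  · simp [hk]

lemma T1_mul_T2 (P Q : Matrix n n R) (p q : n × n) :
    (T1 P * T2 Q) p q = P p.1 q.1 * Q p.2 q.2 := by
  simp [T1, T2, Matrix.mul_apply, Fintype.sum_prod_type]

lemma T2_mul_T1 (P Q : Matrix n n R) (p q : n × n) :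
    (T2 Q * T1 P) p q = Q p.2 q.2 * P p.1 q.1 := by
  simp [T1, T2, Matrix.mul_apply, Fintype.sum_prod_type]

lemma S_mul (M : Matrix (n × n) (n × n) R) (p q : n × n) : (S R n * M) p q = M p.swap q := by
  rw [Matrix.mul_apply, Finset.sum_eq_single p.swap]
  · simp [S]
  · intro b _ hb
    have : p ≠ b.swap := fun h => hb (by simp [h])
    simp [S, this]
  · simp

lemma mul_S (M : Matrix (n × n) (n × n) R) (p q : n × n) : (M * S R n) p q = M p q.swap := by
  rw [Matrix.mul_apply, Finset.sum_eq_single q.swap]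
  · simp [S]
  · intro b _ hb
    simp [S, hb]
  · simp

/-- Yangian relation. -/
def Y {m n : Type*} (c : R) (P Q : Matrix m n R) : Prop :=
  ∀ i h j k, c * (P i j * Q h k - Q h k * P i j) = Q h j * P i k - P h j * Q i k

/-- Alternative (sign reversed) relation. -/
def Y' {m n : Type*} (c : R) (P Q : Matrix m n R) : Prop :=
  ∀ i h j k, c * (P i j * Q h k - Q h k * P i j) = -(P i k * Q h j - Q i k * P h j)

lemma Y_iff {c : R} (hc : ∀ x, c * x = x * c) (P Q : Matrix n n R) :
    Y c P Q ↔ (Matrix.diagonal (fun _ => c) + S R n) * (T1 P * T2 Q) =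
      (T2 Q * T1 P) * (Matrix.diagonal (fun _ => c) + S R n) := by
  have key : ∀ i h j k, (c * (P i j * Q h k - Q h k * P i j) = Q h j * P i k - P h j * Q i k) ↔
      ((Matrix.diagonal (fun _ => c) + S R n) * (T1 P * T2 Q) : Matrix (n × n) (n × n) R)
        (i, h) (j, k) =
      ((T2 Q * T1 P) * (Matrix.diagonal (fun _ => c) + S R n) : Matrix (n × n) (n × n) R)
        (i, h) (j, k) := by
    intro i h j k
    rw [add_mul, mul_add, Matrix.add_apply, Matrix.add_apply, S_mul, mul_S,
      Matrix.diagonal_mul, Matrix.mul_diagonal, T1_mul_T2, T1_mul_T2, T2_mul_T1, T2_mul_T1, ← hc]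
    simp only [Prod.swap, Prod.fst, Prod.snd]
    rw [mul_sub, sub_eq_sub_iff_add_eq_add, add_comm (Q h j * P i k)]
  constructor
  · intro H
    ext ⟨i, h⟩ ⟨j, k⟩
    exact (key i h j k).1 (H i h j k)
  · intro H i h j k
    exact (key i h j k).2 (by rw [H])

lemma Y'_iff {c : R} (hc : ∀ x, c * x = x * c) (P Q : Matrix n n R) :
    Y' c P Q ↔ (T1 P * T2 Q) * (Matrix.diagonal (fun _ => c) + S R n) =
      (Matrix.diagonal (fun _ => c) + S R n) * (T2 Q * T1 P) := by
  have key : ∀ i h j k, (c * (P i j * Q h k - Q h k * P i j) = -(P i k * Q h j - Q i k * P h j)) ↔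
      ((T1 P * T2 Q) * (Matrix.diagonal (fun _ => c) + S R n) : Matrix (n × n) (n × n) R)
        (i, h) (j, k) =
      ((Matrix.diagonal (fun _ => c) + S R n) * (T2 Q * T1 P) : Matrix (n × n) (n × n) R)
        (i, h) (j, k) := by
    intro i h j k
    rw [add_mul, mul_add, Matrix.add_apply, Matrix.add_apply, S_mul, mul_S,
      Matrix.diagonal_mul, Matrix.mul_diagonal, T1_mul_T2, T1_mul_T2, T2_mul_T1, T2_mul_T1, ← hc]
    simp only [Prod.swap, Prod.fst, Prod.snd]
    rw [mul_sub, neg_sub, sub_eq_sub_iff_add_eq_add, add_comm (Q i k * P h j)]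
  constructor
  · intro H
    ext ⟨i, h⟩ ⟨j, k⟩
    exact (key i h j k).1 (H i h j k)
  · intro H i h j k
    exact (key i h j k).2 (by rw [H])

lemma conj_aux {A : Type*} [Ring A] {r x x' y y' : A} (h : r * x = y * r)
    (hx : x * x' = 1) (hy : y' * y = 1) : y' * r = r * x' := by
  calc y' * r = y' * (r * (x * x')) := by rw [hx, mul_one]
    _ = y' * ((r * x) * x') := by rw [mul_assoc]
    _ = (y' * y) * (r * x') := by rw [h]; simp only [mul_assoc]
    _ = r * x' := by rw [hy, one_mul]

lemma pair_inv {A : Type*} [Ring A] {x x' y y' : A} (hx : x * x' = 1) (hy : y * y' = 1) :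
    (x * y) * (y' * x') = 1 := by
  rw [mul_assoc, ← mul_assoc y, hy, one_mul, hx]

lemma Y.inv {c : R} (hc : ∀ x, c * x = x * c) {P Q P' Q' : Matrix n n R}
    (hP : P * P' = 1) (hP' : P' * P = 1) (hQ : Q * Q' = 1) (hQ' : Q' * Q = 1)
    (h : Y c P Q) : Y' c P' Q' := by
  rw [Y_iff hc] at h
  rw [Y'_iff hc]
  exact conj_aux h (pair_inv (T1_inv hP) (T2_inv hQ)) (pair_inv (T1_inv hP') (T2_inv hQ'))

lemma Y'.inv {c : R} (hc : ∀ x, c * x = x * c) {P Q P' Q' : Matrix n n R}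
    (hP : P * P' = 1) (hP' : P' * P = 1) (hQ : Q * Q' = 1) (hQ' : Q' * Q = 1)
    (h : Y' c P Q) : Y c P' Q' := by
  rw [Y'_iff hc] at h
  rw [Y_iff hc]
  exact (conj_aux h.symm (pair_inv (T2_inv hQ) (T1_inv hP))
    (pair_inv (T2_inv hQ') (T1_inv hP'))).symm

lemma pull {R : Type*} [Ring R] {x y : R} (hx : ∀ z, x * z = z * x) (hy : ∀ z, y * z = z * y)
    (a b : R) : (a * x) * (b * y) = (x * y) * (a * b) := by
  calc (a * x) * (b * y) = a * ((x * b) * y) := by simp only [mul_assoc]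
    _ = (a * b) * (x * y) := by rw [hx b]; simp only [mul_assoc]
    _ = x * (a * b) * y := by rw [hx (a * b)]; simp only [mul_assoc]
    _ = (x * y) * (a * b) := by rw [mul_assoc, ← hy (a * b), mul_assoc]

lemma pull' {R : Type*} [Ring R] {x y : R} (hx : ∀ z, x * z = z * x) (hy : ∀ z, y * z = z * y)
    (a b : R) : (b * y) * (a * x) = (x * y) * (b * a) := by
  rw [pull hy hx, hx y]

lemma Y'.mul_right {m o : Type*} {c : R} (hc : ∀ x, c * x = x * c) {P Q : Matrix m n R}
    (X : Matrix n o R) (hX : ∀ a b z, X a b * z = z * X a b) (h : Y' c P Q) :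
    Y' c (P * X) (Q * X) := by
  intro i l j k
  simp only [Matrix.mul_apply]
  rw [Finset.sum_mul_sum, Finset.sum_mul_sum, Finset.sum_mul_sum, Finset.sum_mul_sum]
  rw [Finset.sum_comm (f := fun a b => Q l a * X a k * (P i b * X b j)),
    Finset.sum_comm (f := fun a b => P i a * X a k * (Q l b * X b j)),
    Finset.sum_comm (f := fun a b => Q i a * X a k * (P l b * X b j))]
  simp only [← Finset.sum_sub_distrib, ← Finset.sum_neg_distrib, Finset.mul_sum]
  refine Finset.sum_congr rfl fun a _ => Finset.sum_congr rfl fun b _ => ?_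
  rw [pull (hX a j) (hX b k), pull' (hX a j) (hX b k), pull' (hX a j) (hX b k),
    pull' (hX a j) (hX b k), ← mul_sub, ← mul_sub, ← mul_assoc, hc, mul_assoc, h i l a b, mul_neg]

lemma Y'.mul_left {m o : Type*} {c : R} (hc : ∀ x, c * x = x * c) {P Q : Matrix n m R}
    (X : Matrix o n R) (hX : ∀ a b z, X a b * z = z * X a b) (h : Y' c P Q) :
    Y' c (X * P) (X * Q) := by
  intro i l j k
  simp only [Matrix.mul_apply]
  simp only [fun a b (z : R) => hX a b z]
  rw [Finset.sum_mul_sum, Finset.sum_mul_sum, Finset.sum_mul_sum, Finset.sum_mul_sum]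
  rw [Finset.sum_comm (f := fun a b => Q a k * X l a * (P b j * X i b))]
  simp only [← Finset.sum_sub_distrib, ← Finset.sum_neg_distrib, Finset.mul_sum]
  refine Finset.sum_congr rfl fun a _ => Finset.sum_congr rfl fun b _ => ?_
  rw [pull (hX i a) (hX l b), pull' (hX i a) (hX l b), pull (hX i a) (hX l b),
    pull (hX i a) (hX l b), ← mul_sub, ← mul_sub, ← mul_assoc, hc, mul_assoc, h a b j k, mul_neg]

variable {U : Type*} [Ring U]

/-- Two variable series: inner variable `z`, outer variable `w`. -/
abbrev RR (U : Type*) [Ring U] := HahnSeries ℤ (HahnSeries ℤ U)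

/-- `a(z)`. -/
noncomputable def f1 : HahnSeries ℤ U →+* RR U := HahnSeries.C

/-- `a(w)`. -/
noncomputable def f2 : HahnSeries ℤ U →+* RR U where
  toFun x := x.map (HahnSeries.C : U →+* HahnSeries ℤ U)
  map_zero' := by ext; simp
  map_one' := HahnSeries.map_one (HahnSeries.C : U →+* HahnSeries ℤ U).toMonoidWithZeroHom
  map_add' x y := by ext; simp
  map_mul' x y := HahnSeries.map_mul
    ((HahnSeries.C : U →+* HahnSeries ℤ U) : U →ₙ+* HahnSeries ℤ U)

lemma coeff_f1_mul (a : HahnSeries ℤ U) (x : RR U) (n : ℤ) :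
    (f1 a * x).coeff n = a * x.coeff n := HahnSeries.coeff_single_zero_mul

lemma coeff_mul_f1 (a : HahnSeries ℤ U) (x : RR U) (n : ℤ) :
    (x * f1 a).coeff n = x.coeff n * a := HahnSeries.coeff_mul_single_zero

lemma coeff_f2 (a : HahnSeries ℤ U) (n : ℤ) :
    (f2 a).coeff n = HahnSeries.C (a.coeff n) := rfl

lemma coeff12 (a b : HahnSeries ℤ U) (m n : ℤ) :
    ((f1 a * f2 b).coeff n).coeff m = a.coeff m * b.coeff n := by
  rw [coeff_f1_mul, coeff_f2]
  exact HahnSeries.coeff_mul_single_zero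

lemma coeff21 (a b : HahnSeries ℤ U) (m n : ℤ) :
    ((f2 b * f1 a).coeff n).coeff m = b.coeff n * a.coeff m := by
  rw [coeff_mul_f1, coeff_f2]
  exact HahnSeries.coeff_single_zero_mul

/-- `z - w`. -/
noncomputable def cc (U : Type*) [Ring U] : RR U :=
  f1 (HahnSeries.single (-1) 1) - HahnSeries.single (-1) 1

lemma coeff_cc_mul (x : RR U) (m n : ℤ) : ((cc U * x).coeff n).coeff m =
    (x.coeff n).coeff (m + 1) - (x.coeff (n + 1)).coeff m := by
  rw [cc, sub_mul, HahnSeries.coeff_sub, HahnSeries.coeff_sub, coeff_f1_mul,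
    HahnSeries.coeff_single_mul, HahnSeries.coeff_single_mul]
  simp

lemma coeff_mul_cc (x : RR U) (m n : ℤ) : ((x * cc U).coeff n).coeff m =
    (x.coeff n).coeff (m + 1) - (x.coeff (n + 1)).coeff m := by
  rw [cc, mul_sub, HahnSeries.coeff_sub, HahnSeries.coeff_sub, coeff_mul_f1,
    HahnSeries.coeff_mul_single, HahnSeries.coeff_mul_single]
  simp

lemma cc_comm (x : RR U) : cc U * x = x * cc U := by
  ext n m
  rw [coeff_cc_mul, coeff_mul_cc]

lemma isYangian_iff {m n : Type*} (A : Matrix m n (LaurentSeries U)) :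
    IsYangianType A ↔ Y (cc U) (A.map f1) (A.map f2) := by
  have key : ∀ i h j k p q, (((cc U * (f1 (A i j) * f2 (A h k) - f2 (A h k) * f1 (A i j))).coeff
      q).coeff p = ((A i j).coeff (p + 1) * (A h k).coeff q - (A h k).coeff q * (A i j).coeff (p + 1))
      - ((A i j).coeff p * (A h k).coeff (q + 1) - (A h k).coeff (q + 1) * (A i j).coeff p)) ∧
      (((f2 (A h j) * f1 (A i k) - f1 (A h j) * f2 (A i k)).coeff q).coeff p =
      (A h j).coeff q * (A i k).coeff p - (A h j).coeff p * (A i k).coeff q) := by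
    intro i h j k p q
    constructor
    · rw [coeff_cc_mul]
      simp only [HahnSeries.coeff_sub, coeff12, coeff21]
    · simp only [HahnSeries.coeff_sub, coeff12, coeff21]
  constructor
  · intro H i h j k
    simp only [Matrix.map_apply]
    ext q p
    rw [(key i h j k p q).1, (key i h j k p q).2]
    exact H i h j k p q
  · intro H i h j k p q
    have := H i h j k
    simp only [Matrix.map_apply] at this
    rw [← (key i h j k p q).1, ← (key i h j k p q).2, this]

lemma central_f1 {u : U} (hu : u ∈ Subring.center U) (z : RR U) :
    f1 (HahnSeries.C u) * z = z * f1 (HahnSeries.C u) := by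
  ext n m
  rw [coeff_f1_mul, coeff_mul_f1]
  have h1 : ((HahnSeries.C u : HahnSeries ℤ U) * z.coeff n).coeff m = u * (z.coeff n).coeff m :=
    HahnSeries.coeff_single_zero_mul
  have h2 : (z.coeff n * (HahnSeries.C u : HahnSeries ℤ U)).coeff m = (z.coeff n).coeff m * u :=
    HahnSeries.coeff_mul_single_zero
  rw [h1, h2]
  exact (Subring.mem_center_iff.1 hu _).symm

lemma f2_C (u : U) : f2 (HahnSeries.C u) = f1 (HahnSeries.C u) :=
  HahnSeries.map_C u (HahnSeries.C : U →+* HahnSeries ℤ U)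

lemma map_inv {A B : Type*} [Ring A] [Ring B] (f : A →+* B) {P P' : Matrix n n A}
    (h : P * P' = 1) : P.map f * P'.map f = 1 := by
  rw [← Matrix.map_mul, h, Matrix.map_one f f.map_zero f.map_one]

lemma abstract_final {K R : Type*} [Ring K] [Ring R] (f g : K →+* R) (c : R)
    (hc : ∀ x, c * x = x * c)
    {n m : Type*} [Fintype n] [DecidableEq n] [Fintype m] [DecidableEq m]
    (A B : Matrix n n K) (J : Matrix m n K) (I : Matrix n m K) (Q : Matrix m m K)
    (hA : Y c (A.map f) (A.map g))
    (cJ : ∀ a b z, f (J a b) * z = z * f (J a b))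
    (cI : ∀ a b z, f (I a b) * z = z * f (I a b))
    (eJ : ∀ a b, g (J a b) = f (J a b))
    (eI : ∀ a b, g (I a b) = f (I a b))
    (a1 : A * B = 1) (a2 : B * A = 1) (q1 : (J * B * I) * Q = 1) (q2 : Q * (J * B * I) = 1) :
    Y c (Q.map f) (Q.map g) := by
  have hB : Y' c (B.map f) (B.map g) :=
    Y.inv hc (map_inv f a1) (map_inv f a2) (map_inv g a1) (map_inv g a2) hA
  have eJ' : J.map g = J.map f := by
    ext1 a b
    exact eJ a b
  have eI' : I.map g = I.map f := by
    ext1 a b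
    exact eI a b
  have hB2 := (hB.mul_left hc (J.map f) cJ).mul_right hc (I.map f) cI
  refine Y'.inv hc (map_inv f q1) (map_inv f q2) (map_inv g q1) (map_inv g q2) ?_
  rw [Matrix.map_mul, Matrix.map_mul, Matrix.map_mul, Matrix.map_mul, eI', eJ']
  exact hB2

lemma final {n m : Type*} [Fintype n] [DecidableEq n] [Fintype m] [DecidableEq m]
    (A B : Matrix n n (HahnSeries ℤ U)) (J : Matrix m n (HahnSeries ℤ U))
    (I : Matrix n m (HahnSeries ℤ U)) (Q : Matrix m m (HahnSeries ℤ U))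
    (hA : IsYangianType A)
    (hJ : ∀ a b, ∃ u ∈ Subring.center U, J a b = HahnSeries.C u)
    (hI : ∀ a b, ∃ u ∈ Subring.center U, I a b = HahnSeries.C u)
    (a1 : A * B = 1) (a2 : B * A = 1) (q1 : (J * B * I) * Q = 1) (q2 : Q * (J * B * I) = 1) :
    IsYangianType Q := by
  refine (isYangian_iff Q).2 (abstract_final (K := HahnSeries ℤ U) (R := RR U) f1 f2 (cc U) cc_comm A B J I Q
    ((isYangian_iff A).1 hA) ?_ ?_ ?_ ?_ a1 a2 q1 q2)
  · intro a b z
    obtain ⟨u, hu, e⟩ := hJ a b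
    rw [e]
    exact central_f1 hu z
  · intro a b z
    obtain ⟨u, hu, e⟩ := hI a b
    rw [e]
    exact central_f1 hu z
  · intro a b
    obtain ⟨u, hu, e⟩ := hJ a b
    rw [e, f2_C]
  · intro a b
    obtain ⟨u, hu, e⟩ := hI a b
    rw [e, f2_C]

end YangianAux

end YangianHelpers

/-- Let `U` be a unital associative algebra over a field `𝔽` of characteristic 0
with center `Z`, and let `A(z) ∈ Mat_{N×N}(U((z⁻¹)))` be an operator of Yangian type. Let
`I ∈ Mat_{N×M}(Z)`, `J ∈ Mat_{M×N}(Z)` with `M ≤ N`. If `A(z)` is invertible and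
`J·A(z)⁻¹·I ∈ Mat_{M×M}(U((z⁻¹)))` is invertible, then the generalized quasideterminant
`|A(z)|_{IJ} = (J·A(z)⁻¹·I)⁻¹` is an operator of Yangian type. -/
theorem stmt_6 {𝔽 : Type*} [Field 𝔽] [CharZero 𝔽] {U : Type*} [Ring U] [Algebra 𝔽 U]
    {N M : ℕ} (hMN : M ≤ N)
    (A : Matrix (Fin N) (Fin N) (LaurentSeries U)) (hA : IsYangianType A)
    (I : Matrix (Fin N) (Fin M) U) (J : Matrix (Fin M) (Fin N) U)
    (hI : ∀ a b, I a b ∈ Subring.center U) (hJ : ∀ a b, J a b ∈ Subring.center U)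
    (hAinv : IsUnit A)
    (hQinv : IsUnit
      (J.map (HahnSeries.C : U →+* HahnSeries ℤ U) * Ring.inverse A *
        I.map (HahnSeries.C : U →+* HahnSeries ℤ U))) :
    IsYangianType
      (Ring.inverse
        (J.map (HahnSeries.C : U →+* HahnSeries ℤ U) * Ring.inverse A *
          I.map (HahnSeries.C : U →+* HahnSeries ℤ U))) := by
  exact YangianAux.final A (Ring.inverse A) _ _ _ hA
    (fun a b => ⟨J a b, hJ a b, rfl⟩) (fun a b => ⟨I a b, hI a b, rfl⟩)
    (Ring.mul_inverse_cancel _ hAinv) (Ring.inverse_mul_cancel _ hAinv)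
    (Ring.mul_inverse_cancel _ hQinv) (Ring.inverse_mul_cancel _ hQinv)
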